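/- Let K, D, C be positive integers, γ : ℝ with γ > 0, N : Fin K → ℕ, and for each client k let Φ_k : Matrix (Fin (N k)) (Fin D) ℝ and Y_k : Matrix (Fin (N k)) (Fin C) ℝ, with vertical stacks Φ and Y indexed by Σ k : Fin K, Fin (N k). Suppose Φᵀ * Φ is invertible. Define the transmitted quantities C_k = (Φ_k)ᵀ * Φ_k + γ • 1 and M_k = (Φ_k)ᵀ * Y_k, and their single-round aggregates C_agg = ∑_k C_k and M_agg = ∑_k M_k. Then the server's recovery formula yields exactly the centralized least-squares solution: (C_agg − (K * γ) • 1)⁻¹ * M_agg = (Φᵀ * Φ)⁻¹ * Φᵀ * Y, and this matrix is the unique global minimizer of W ↦ ∑_{⟨k,n⟩, c} (Y ⟨k,n⟩ c − (Φ * W) ⟨k,n⟩ c)^2. -/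

import Mathlib

open Matrix

/-- The Gram matrix of a vertical stack is the sum of the products of the blocks. -/
lemma transpose_mul_sigma_eq_sum {κ m n R : Type*} {ν : κ → Type*} [Fintype κ]
    [∀ k, Fintype (ν k)] [NonUnitalNonAssocSemiring R]
    (A : Matrix (Σ k, ν k) m R) (B : Matrix (Σ k, ν k) n R) :
    Aᵀ * B = ∑ k, (A.submatrix (Sigma.mk k) id)ᵀ * B.submatrix (Sigma.mk k) id := by
  ext i j
  simp [Matrix.mul_apply, Matrix.sum_apply, Fintype.sum_sigma]

/-- When the Gram matrix of `A` is invertible, a solution of the normal equations is the unique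
minimizer of the sum of squared residuals. -/
lemma sum_sq_residual_lt_of_normal_equation {p m n : Type*} [Fintype p] [Fintype m]
    [DecidableEq m] [Fintype n] {A : Matrix p m ℝ} {Y : Matrix p n ℝ} {W₀ W : Matrix m n ℝ}
    (hA : IsUnit (Aᵀ * A)) (hW₀ : Aᵀ * (Y - A * W₀) = 0) (hW : W ≠ W₀) :
    ∑ i, ∑ j, (Y i j - (A * W₀) i j) ^ 2 < ∑ i, ∑ j, (Y i j - (A * W) i j) ^ 2 := by
  set E := A * (W₀ - W) with hE
  have hcross : ∑ i, ∑ j, E i j * (Y i j - (A * W₀) i j) = 0 := by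
    have h : (Eᵀ * (Y - A * W₀)).trace = 0 := by
      rw [hE, Matrix.transpose_mul, Matrix.mul_assoc, hW₀, Matrix.mul_zero, Matrix.trace_zero]
    rw [Finset.sum_comm]
    simpa [Matrix.trace, Matrix.mul_apply] using h
  have hsplit : ∑ i, ∑ j, (Y i j - (A * W) i j) ^ 2 =
      ∑ i, ∑ j, (Y i j - (A * W₀) i j) ^ 2 +
        2 * ∑ i, ∑ j, E i j * (Y i j - (A * W₀) i j) + ∑ i, ∑ j, E i j ^ 2 := by
    simp only [Finset.mul_sum, ← Finset.sum_add_distrib]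
    refine Finset.sum_congr rfl fun i _ => Finset.sum_congr rfl fun j _ => ?_
    rw [hE, Matrix.mul_sub, Matrix.sub_apply]
    ring
  have hE_ne : E ≠ 0 := by
    intro h
    have hgram : Aᵀ * A * (W₀ - W) = 0 := by
      rw [Matrix.mul_assoc, ← hE, h, Matrix.mul_zero]
    have hzero : W₀ - W = 0 := by
      rw [← Matrix.nonsing_inv_mul_cancel_left (Aᵀ * A) (W₀ - W)
        ((Matrix.isUnit_iff_isUnit_det _).mp hA), hgram, Matrix.mul_zero]
    exact hW (sub_eq_zero.mp hzero).symm
  obtain ⟨i, j, hij⟩ : ∃ i j, E i j ≠ 0 := by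
    by_contra! h
    exact hE_ne (Matrix.ext h)
  have hpos : 0 < ∑ i, ∑ j, E i j ^ 2 :=
    Finset.sum_pos' (fun _ _ => Finset.sum_nonneg fun _ _ => sq_nonneg _)
      ⟨i, Finset.mem_univ i, Finset.sum_pos' (fun _ _ => sq_nonneg _)
        ⟨j, Finset.mem_univ j, by positivity⟩⟩
  linarith

/-- Federated Analytic Solution (Theorem 1 of the paper, invertible case): from
the single-round aggregates `C_agg = ∑_k (Φ_kᵀ Φ_k + γ•1)` and
`M_agg = ∑_k Φ_kᵀ Y_k`, the server's recovery formula
`(C_agg − (K γ)•1)⁻¹ M_agg` equals the centralized least-squares solution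
`(Φᵀ Φ)⁻¹ Φᵀ Y`, which is the unique global minimizer of the centralized
objective. -/
theorem federated_analytic_solution
    (K D C : ℕ) (hK : 0 < K) (hD : 0 < D) (hC : 0 < C)
    (γ : ℝ) (hγ : 0 < γ)
    (N : Fin K → ℕ)
    (Φloc : ∀ k : Fin K, Matrix (Fin (N k)) (Fin D) ℝ)
    (Yloc : ∀ k : Fin K, Matrix (Fin (N k)) (Fin C) ℝ)
    (Φ : Matrix (Σ k : Fin K, Fin (N k)) (Fin D) ℝ)
    (Y : Matrix (Σ k : Fin K, Fin (N k)) (Fin C) ℝ)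
    (hΦ : ∀ (k : Fin K) (n : Fin (N k)) (d : Fin D), Φ ⟨k, n⟩ d = Φloc k n d)
    (hY : ∀ (k : Fin K) (n : Fin (N k)) (c : Fin C), Y ⟨k, n⟩ c = Yloc k n c)
    (hinv : IsUnit (Φᵀ * Φ))
    (Cloc : Fin K → Matrix (Fin D) (Fin D) ℝ)
    (hCloc : ∀ k : Fin K,
      Cloc k = (Φloc k)ᵀ * Φloc k + γ • (1 : Matrix (Fin D) (Fin D) ℝ))
    (Mloc : Fin K → Matrix (Fin D) (Fin C) ℝ)
    (hMloc : ∀ k : Fin K, Mloc k = (Φloc k)ᵀ * Yloc k)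
    (Cagg : Matrix (Fin D) (Fin D) ℝ) (hCagg : Cagg = ∑ k : Fin K, Cloc k)
    (Magg : Matrix (Fin D) (Fin C) ℝ) (hMagg : Magg = ∑ k : Fin K, Mloc k) :
    (Cagg - ((K : ℝ) * γ) • (1 : Matrix (Fin D) (Fin D) ℝ))⁻¹ * Magg =
        (Φᵀ * Φ)⁻¹ * Φᵀ * Y ∧
      ∀ W : Matrix (Fin D) (Fin C) ℝ,
        W ≠ (Cagg - ((K : ℝ) * γ) • (1 : Matrix (Fin D) (Fin D) ℝ))⁻¹ * Magg →
          (∑ p : Σ k : Fin K, Fin (N k), ∑ c : Fin C,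
              (Y p c - (Φ * ((Cagg - ((K : ℝ) * γ) •
                (1 : Matrix (Fin D) (Fin D) ℝ))⁻¹ * Magg)) p c) ^ 2) <
            ∑ p : Σ k : Fin K, Fin (N k), ∑ c : Fin C,
              (Y p c - (Φ * W) p c) ^ 2 := by
  have hΦ_block (k : Fin K) : Φ.submatrix (Sigma.mk k) id = Φloc k := Matrix.ext (hΦ k)
  have hY_block (k : Fin K) : Y.submatrix (Sigma.mk k) id = Yloc k := Matrix.ext (hY k)
  have hgram : Cagg - ((K : ℝ) * γ) • (1 : Matrix (Fin D) (Fin D) ℝ) = Φᵀ * Φ := by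
    simp [hCagg, hCloc, transpose_mul_sigma_eq_sum, hΦ_block, Finset.sum_add_distrib,
      mul_smul, Nat.cast_smul_eq_nsmul]
  have hmoment : Magg = Φᵀ * Y := by
    simp [hMagg, hMloc, transpose_mul_sigma_eq_sum, hΦ_block, hY_block]
  rw [hgram, hmoment]
  refine ⟨(Matrix.mul_assoc _ _ _).symm, fun W hW =>
    sum_sq_residual_lt_of_normal_equation hinv ?_ hW⟩
  rw [Matrix.mul_sub, ← Matrix.mul_assoc Φᵀ Φ, Matrix.mul_nonsing_inv_cancel_left _ _
    ((Matrix.isUnit_iff_isUnit_det _).mp hinv), sub_self]
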